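/- Let T be a finite tree with nonnegative real edge weights w, let r be a vertex of T, and let S be a set of vertices of T. Then the minimum, over all closed walks in T that start and end at r and visit every vertex of S, of the total weight of the walk (edges counted with multiplicity) equals 2 \sum_{e \in E(T_S)} w(e), where T_S is the unique minimal subtree of T containing S \cup \{r\}. -/

import Mathlib

open scoped Classical

/-- A finite rooted tree on the vertex type `V`, given by its parent function: the root is a
fixed point of `parent` and every vertex reaches the root by iterating `parent`. -/
structure ParentTree (V : Type*) where
  parent : V → V
  root : V
  root_fix : parent root = root
  reach : ∀ v, ∃ m : ℕ, parent^[m] v = root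

namespace ParentTree

variable {V : Type*} [Fintype V]

/-- Tree adjacency: `u` and `v` are joined by a tree edge. -/
def Adj (T : ParentTree V) (u v : V) : Prop :=
  u ≠ v ∧ (T.parent u = v ∨ T.parent v = u)

/-- The cost of traversing the tree edge between adjacent vertices `u` and `v`, where
`w x` is the weight of the edge from `x` to its parent. -/
noncomputable def stepCost (T : ParentTree V) (w : V → ℝ) (u v : V) : ℝ :=
  if T.parent u = v then w u else w v

/-- The weight of a walk: the sum of the weights of its edges counted with multiplicity. -/
noncomputable def walkCost (T : ParentTree V) (w : V → ℝ) (l : List V) : ℝ :=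
  ((l.zip l.tail).map (fun q => T.stepCost w q.1 q.2)).sum

/-- A CVRP tour in the tree `T` with capacity `Q`: a closed walk starting and ending at the
root (depot) together with an assignment of the number of tokens picked up at each vertex it
visits, totalling at most `Q`. -/
structure Tour (T : ParentTree V) (Q : ℕ) where
  walk : List V
  pickup : V → ℕ
  walk_ne : walk ≠ []
  chain : walk.Chain' T.Adj
  head_eq : walk.head walk_ne = T.root
  last_eq : walk.getLast walk_ne = T.root
  pickup_mem : ∀ v, pickup v ≠ 0 → v ∈ walk
  cap : ∑ v, pickup v ≤ Q

/-- A solution (finite multiset of tours) is feasible for the demand `d` if for every vertex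
`v` the tokens picked up at `v` over all tours sum to exactly `d v`. -/
def Feasible (T : ParentTree V) (Q : ℕ) (d : V → ℕ) (S : Multiset (T.Tour Q)) : Prop :=
  ∀ v, (S.map (fun t => t.pickup v)).sum = d v

/-- The cost of a tour. -/
noncomputable def tourCost (T : ParentTree V) (w : V → ℝ) {Q : ℕ} (t : T.Tour Q) : ℝ :=
  T.walkCost w t.walk

/-- The cost of a solution: the sum of the costs of its tours. -/
noncomputable def solCost (T : ParentTree V) (w : V → ℝ) {Q : ℕ}
    (S : Multiset (T.Tour Q)) : ℝ :=
  (S.map (fun t => T.tourCost w t)).sum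

/-- The optimum CVRP value `opt(T, d, Q)`. -/
noncomputable def opt (T : ParentTree V) (w : V → ℝ) (d : V → ℕ) (Q : ℕ) : ℝ :=
  sInf {c : ℝ | ∃ S : Multiset (T.Tour Q), T.Feasible Q d S ∧ T.solCost w S = c}

/-- The height of the rooted tree (the maximum number of edges on a root-to-leaf path) is at
most `H`. -/
def heightLE (T : ParentTree V) (H : ℝ) : Prop :=
  ∀ v, ∃ m : ℕ, (m : ℝ) ≤ H ∧ T.parent^[m] v = T.root

end ParentTree

namespace ParentTree

variable {V : Type*}

/-- The number of edges between `v` and the root. -/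
noncomputable def depth (T : ParentTree V) (v : V) : ℕ := Nat.find (T.reach v)

lemma depth_parent_lt (T : ParentTree V) {v : V} (hv : v ≠ T.root) :
    T.depth (T.parent v) < T.depth v := by
  have h := Nat.find_spec (T.reach v)
  change T.parent^[T.depth v] v = T.root at h
  obtain hn | ⟨n, hn⟩ : T.depth v = 0 ∨ ∃ n, T.depth v = n + 1 := by
    cases T.depth v <;> simp
  · rw [hn] at h
    exact absurd h hv
  · rw [hn] at h ⊢
    exact Nat.lt_succ_of_le (Nat.find_min' _ (by simpa using h))

lemma depth_parent_le (T : ParentTree V) (v : V) : T.depth (T.parent v) ≤ T.depth v := by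
  by_cases hv : v = T.root
  · rw [hv, T.root_fix]
  · exact (T.depth_parent_lt hv).le

lemma depth_iterate_le (T : ParentTree V) (m : ℕ) (v : V) :
    T.depth (T.parent^[m] v) ≤ T.depth v := by
  induction m generalizing v with
  | zero => rfl
  | succ m ih => exact (ih _).trans (T.depth_parent_le v)

/-- `T.Below x y` says that `y` lies in the subtree rooted at `x`. -/
def Below (T : ParentTree V) (x y : V) : Prop := ∃ m : ℕ, T.parent^[m] y = x

lemma below_iff (T : ParentTree V) (x y : V) :
    T.Below x y ↔ y = x ∨ T.Below x (T.parent y) := by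
  constructor
  · rintro ⟨_ | m, h⟩
    · exact .inl h
    · exact .inr ⟨m, h⟩
  · rintro (h | ⟨m, h⟩)
    · exact ⟨0, h⟩
    · exact ⟨m + 1, h⟩

lemma not_below_parent (T : ParentTree V) {v : V} (hv : v ≠ T.root) :
    ¬ T.Below v (T.parent v) := by
  rintro ⟨m, h⟩
  have h1 := T.depth_iterate_le m (T.parent v)
  rw [h] at h1
  exact absurd (T.depth_parent_lt hv) h1.not_gt

lemma not_below_root (T : ParentTree V) {x : V} (hx : x ≠ T.root) : ¬ T.Below x T.root := by
  rintro ⟨m, h⟩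
  exact hx (h ▸ Function.iterate_fixed T.root_fix m)

/-- The indicator function of the subtree rooted at `x`. -/
noncomputable def belowInd (T : ParentTree V) (x y : V) : ℝ := if T.Below x y then 1 else 0

lemma belowInd_sub_parent (T : ParentTree V) {u : V} (hu : u ≠ T.root) (x : V) :
    |T.belowInd x u - T.belowInd x (T.parent u)| = if x = u then 1 else 0 := by
  unfold belowInd
  rw [T.below_iff x u]
  by_cases h : x = u
  · subst h
    simp [T.not_below_parent hu]
  · simp [h, Ne.symm h]

lemma ne_root_of_parent_ne (T : ParentTree V) {u : V} (h : u ≠ T.parent u) : u ≠ T.root := by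
  rintro rfl
  exact h T.root_fix.symm

lemma stepCost_parent (T : ParentTree V) (w : V → ℝ) (u : V) :
    T.stepCost w u (T.parent u) = w u := by
  simp [stepCost]

lemma stepCost_from_parent (T : ParentTree V) (w : V → ℝ) {u : V} (hu : u ≠ T.root) :
    T.stepCost w (T.parent u) u = w u := by
  rw [stepCost, ite_eq_right_iff]
  intro h
  exact absurd ⟨1, h⟩ (T.not_below_parent hu)

lemma stepCost_eq_sum [Fintype V] (T : ParentTree V) (w : V → ℝ) {u v : V} (h : T.Adj u v) :
    T.stepCost w u v = ∑ x, w x * |T.belowInd x u - T.belowInd x v| := by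
  obtain ⟨hne, rfl | rfl⟩ := h
  · simp [stepCost_parent, T.belowInd_sub_parent (T.ne_root_of_parent_ne hne)]
  · have hv := T.ne_root_of_parent_ne hne.symm
    simp [T.stepCost_from_parent w hv, abs_sub_comm (T.belowInd _ (T.parent v)),
      T.belowInd_sub_parent hv]

@[simp] lemma walkCost_singleton (T : ParentTree V) (w : V → ℝ) (a : V) :
    T.walkCost w [a] = 0 := by
  simp [walkCost]

@[simp] lemma walkCost_cons_cons (T : ParentTree V) (w : V → ℝ) (a b : V) (l : List V) :
    T.walkCost w (a :: b :: l) = T.stepCost w a b + T.walkCost w (b :: l) := by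
  simp [walkCost]

lemma walkCost_append_cons (T : ParentTree V) (w : V → ℝ) (l₁ l₂ : List V) (p : V) :
    T.walkCost w (l₁ ++ p :: l₂) = T.walkCost w (l₁ ++ [p]) + T.walkCost w (p :: l₂) := by
  induction l₁ with
  | nil => simp
  | cons a l ih =>
    cases l with
    | nil => simp
    | cons b l =>
      simp only [List.cons_append, walkCost_cons_cons] at ih ⊢
      rw [ih, add_assoc]

/-- The total variation of `f` along the list `l`. -/
def variation (f : V → ℝ) : List V → ℝ
  | [] => 0
  | [_] => 0
  | a :: b :: l => |f a - f b| + variation f (b :: l)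

lemma variation_nonneg (f : V → ℝ) (l : List V) : 0 ≤ variation f l := by
  fun_induction variation f l with
  | case1 => rfl
  | case2 => rfl
  | case3 a b l ih => positivity

lemma abs_sub_add_abs_sub_le_variation (f : V → ℝ) {a y z : V} {l : List V}
    (hy : y ∈ a :: l) (hz : (a :: l).getLast? = some z) :
    |f a - f y| + |f y - f z| ≤ variation f (a :: l) := by
  induction l generalizing a y with
  | nil =>
    obtain rfl : y = a := by simpa using hy
    obtain rfl : y = z := by simpa using hz
    simp [variation]
  | cons b l ih =>
    rw [List.getLast?_cons_cons] at hz
    rw [variation]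
    rcases List.mem_cons.1 hy with rfl | hy
    · have h1 := ih List.mem_cons_self hz
      have h2 := abs_sub_le (f y) (f b) (f z)
      simp only [sub_self, abs_zero, zero_add] at h1 ⊢
      linarith
    · have h1 := ih hy hz
      have h2 := abs_sub_le (f a) (f b) (f y)
      linarith

lemma walkCost_eq_sum [Fintype V] (T : ParentTree V) (w : V → ℝ) {l : List V}
    (h : l.IsChain T.Adj) : T.walkCost w l = ∑ x, w x * variation (T.belowInd x) l := by
  induction l with
  | nil => simp [walkCost, variation]
  | cons a l ih =>
    cases l with
    | nil => simp [variation]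
    | cons b l =>
      rw [List.isChain_cons_cons] at h
      simp only [walkCost_cons_cons, variation, mul_add, Finset.sum_add_distrib,
        T.stepCost_eq_sum w h.1, ih h.2]

/-- Any parent-closed set of non-root vertices is toured by a closed walk traversing each of
its parent edges exactly twice. -/
lemma exists_closed_walk (T : ParentTree V) (w : V → ℝ) (F : Finset V)
    (hroot : ∀ v ∈ F, v ≠ T.root) (hF : ∀ v ∈ F, T.parent v = T.root ∨ T.parent v ∈ F) :
    ∃ l : List V, l.IsChain T.Adj ∧ l.head? = some T.root ∧ l.getLast? = some T.root ∧
      (∀ v ∈ F, v ∈ l) ∧ T.walkCost w l = 2 * ∑ v ∈ F, w v := by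
  induction F using Finset.strongInduction with
  | H F ih =>
  obtain rfl | hne := F.eq_empty_or_nonempty
  · exact ⟨[T.root], by simp⟩
  obtain ⟨v, hv, hmax⟩ := F.exists_max_image T.depth hne
  have hvr := hroot v hv
  have hleaf : ∀ u ∈ F, T.parent u ≠ v := by
    rintro u hu rfl
    exact absurd (hmax u hu) (T.depth_parent_lt (hroot u hu)).not_ge
  obtain ⟨l, hchain, hhead, hlast, hmem, hcost⟩ := ih (F.erase v) (Finset.erase_ssubset hv)
    (fun u hu => hroot u (Finset.mem_of_mem_erase hu))
    (fun u hu => (hF u (Finset.mem_of_mem_erase hu)).imp_right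
      (Finset.mem_erase.2 ⟨hleaf u (Finset.mem_of_mem_erase hu), ·⟩))
  have hp : T.parent v ∈ l := by
    rcases hF v hv with h | h
    · rw [h]
      exact List.mem_of_mem_head? hhead
    · exact hmem _ (Finset.mem_erase.2 ⟨hleaf v hv, h⟩)
  obtain ⟨l₁, l₂, rfl⟩ := List.append_of_mem hp
  refine ⟨l₁ ++ T.parent v :: v :: T.parent v :: l₂, ?_, ?_, ?_, ?_, ?_⟩
  · rw [List.isChain_split] at hchain ⊢
    exact ⟨hchain.1, .cons_cons ⟨hleaf v hv, .inr rfl⟩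
      (.cons_cons ⟨(hleaf v hv).symm, .inl rfl⟩ hchain.2)⟩
  · cases l₁ <;> simpa using hhead
  · simpa [List.getLast?_append] using hlast
  · intro u hu
    by_cases huv : u = v
    · simp [huv]
    · have := hmem u (Finset.mem_erase.2 ⟨huv, hu⟩)
      simp only [List.mem_append, List.mem_cons] at this ⊢
      tauto
  · rw [walkCost_append_cons] at hcost ⊢
    rw [walkCost_cons_cons, walkCost_cons_cons, T.stepCost_from_parent w hvr, stepCost_parent,
      ← Finset.add_sum_erase F w hv]
    linarith

end ParentTree

/-- Tree TSP lemma: in a finite tree `T` with nonnegative edge weights `w` (rooted at the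
depot `r = T.root`, with `w v` the weight of the edge from `v` to its parent) and a set `S`
of vertices, the minimum total weight (edges counted with multiplicity) of a closed walk
starting and ending at `r` and visiting every vertex of `S` is exactly
`2 ∑_{e ∈ E(T_S)} w e`, where `T_S` is the minimal subtree of `T` containing `S ∪ {r}` —
its edges being exactly the edges `v – parent v` (`v ≠ r`) whose subtree below `v` contains
a vertex of `S`. -/
theorem stmt_15 {V : Type*} [Fintype V] (T : ParentTree V) (w : V → ℝ)
    (hw : ∀ v, 0 ≤ w v) (S : Set V) :
    IsLeast
      {c : ℝ | ∃ l : List V, l ≠ [] ∧ l.Chain' T.Adj ∧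
        l.head? = some T.root ∧ l.getLast? = some T.root ∧
        (∀ s ∈ S, s ∈ l) ∧ T.walkCost w l = c}
      (2 * ∑ v ∈ Finset.univ.filter
          (fun v => v ≠ T.root ∧ ∃ s ∈ S, ∃ m : ℕ, T.parent^[m] s = v), w v) := by
  constructor
  · obtain ⟨l, hchain, hhead, hlast, hmem, hcost⟩ := T.exists_closed_walk w
      (Finset.univ.filter (fun v => v ≠ T.root ∧ ∃ s ∈ S, ∃ m : ℕ, T.parent^[m] s = v))
      (fun v hv => (Finset.mem_filter.1 hv).2.1) (by
        intro v hv
        obtain ⟨-, -, s, hs, m, rfl⟩ := Finset.mem_filter.1 hv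
        refine or_iff_not_imp_left.2 fun h => Finset.mem_filter.2
          ⟨Finset.mem_univ _, h, s, hs, m + 1, Function.iterate_succ_apply' _ _ _⟩)
    refine ⟨l, ?_, hchain, hhead, hlast, fun s hs => ?_, hcost⟩
    · rintro rfl
      simp at hhead
    · by_cases h : s = T.root
      · exact h ▸ List.mem_of_mem_head? hhead
      · exact hmem s (Finset.mem_filter.2 ⟨Finset.mem_univ _, h, s, hs, 0, rfl⟩)
  · rintro _ ⟨l, hl, hchain, hhead, hlast, hmem, rfl⟩
    obtain ⟨a, l, rfl⟩ := List.exists_cons_of_ne_nil hl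
    obtain rfl : a = T.root := by simpa using hhead
    rw [T.walkCost_eq_sum w hchain, Finset.mul_sum]
    refine (Finset.sum_le_sum fun x hx => ?_).trans
      (Finset.sum_le_univ_sum_of_nonneg fun x =>
        mul_nonneg (hw x) (ParentTree.variation_nonneg _ _))
    obtain ⟨-, hxr, s, hs, hsx⟩ := Finset.mem_filter.1 hx
    have h := ParentTree.abs_sub_add_abs_sub_le_variation (T.belowInd x) (hmem s hs) hlast
    have h1 : T.belowInd x s = 1 := if_pos hsx
    have h0 : T.belowInd x T.root = 0 := if_neg (T.not_below_root hxr)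
    rw [h0, h1] at h
    norm_num at h
    rw [mul_comm]
    exact mul_le_mul_of_nonneg_left h (hw x)
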